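/- For a commutative ring R and g ∈ GL_n(R), the determinant of the m-th exterior power satisfies det(⋀^m g) = det(g)^{C(n−1,m−1)}. -/

import Mathlib

open ExteriorAlgebra

variable {R : Type*} [CommRing R] {M : Type*} [AddCommGroup M] [Module R M]

/-- The `m`-th exterior power of an endomorphism. -/
noncomputable def extPow (m : ℕ) (f : M →ₗ[R] M) : ⋀[R]^m M →ₗ[R] ⋀[R]^m M :=
  (ExteriorAlgebra.map f).toLinearMap.restrict (p := ⋀[R]^m M) (q := ⋀[R]^m M)
    (fun x hx => by
      rw [← ιMulti_span_fixedDegree] at hx ⊢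
      induction hx using Submodule.span_induction with
      | mem x hx =>
        obtain ⟨v, rfl⟩ := hx
        refine Submodule.subset_span ⟨f ∘ v, ?_⟩
        simp [AlgHom.toLinearMap_apply]
      | zero => simp
      | add x y _ _ hx hy => rw [map_add]; exact Submodule.add_mem _ hx hy
      | smul c x _ hx => rw [map_smul]; exact Submodule.smul_mem _ c hx)

/-- The wedge `v 0 ∧ ⋯ ∧ v (m-1)` as an element of the `m`-th exterior power. -/
def wedge (m : ℕ) (v : Fin m → M) : ⋀[R]^m M :=
  ⟨ιMulti R m v, ιMulti_range R m ⟨v, rfl⟩⟩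

theorem extPow_eq_map (m : ℕ) (f : M →ₗ[R] M) : extPow m f = exteriorPower.map m f := by
  apply exteriorPower.linearMap_ext
  ext v
  simp [extPow, LinearMap.restrict_apply]
  rfl

/-- determinant of the exterior power of a matrix -/
noncomputable def extDet {S : Type*} [CommRing S] {n : ℕ} (m : ℕ)
    (A : Matrix (Fin n) (Fin n) S) : S :=
  LinearMap.det (exteriorPower.map m A.mulVecLin)

/-- the compound matrix (transposed minors) -/
def compoundMat {S : Type*} [CommRing S] {n : ℕ} (m : ℕ)
    (A : Matrix (Fin n) (Fin n) S) :
    Matrix (Set.powersetCard (Fin n) m) (Set.powersetCard (Fin n) m) S :=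
  Matrix.of fun s t => (Matrix.of fun i j : Fin m =>
    A (Set.powersetCard.ofFinEmbEquiv.symm s j) (Set.powersetCard.ofFinEmbEquiv.symm t i)).det

theorem extDet_eq {S : Type*} [CommRing S] {n : ℕ} (m : ℕ)
    (A : Matrix (Fin n) (Fin n) S) : extDet m A = (compoundMat m A).det := by
  classical
  rw [extDet, ← LinearMap.det_toMatrix ((Pi.basisFun S (Fin n)).exteriorPower m)]
  congr 1
  ext s t
  rw [LinearMap.toMatrix_apply, exteriorPower.basis_repr_apply, exteriorPower.basis_apply,
    exteriorPower.ιMulti_family, exteriorPower.map_apply_ιMulti,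
    exteriorPower.ιMultiDual_apply_ιMulti]
  simp [compoundMat]

theorem extDet_map {S T : Type*} [CommRing S] [CommRing T] {n : ℕ} (m : ℕ) (φ : S →+* T)
    (A : Matrix (Fin n) (Fin n) S) : extDet m (A.map φ) = φ (extDet m A) := by
  rw [extDet_eq, extDet_eq, RingHom.map_det]
  congr 1
  ext s t
  simp only [compoundMat, Matrix.of_apply, RingHom.mapMatrix_apply, Matrix.map_apply,
    RingHom.map_det]
  rfl

theorem extDet_mul {S : Type*} [CommRing S] {n : ℕ} (m : ℕ)
    (A B : Matrix (Fin n) (Fin n) S) : extDet m (A * B) = extDet m A * extDet m B := by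
  rw [extDet, extDet, extDet, Matrix.mulVecLin_mul, exteriorPower.map_comp, LinearMap.det_comp]

theorem extDet_one {S : Type*} [CommRing S] {n : ℕ} (m : ℕ) :
    extDet m (1 : Matrix (Fin n) (Fin n) S) = 1 := by
  rw [extDet, Matrix.mulVecLin_one, exteriorPower.map_id, LinearMap.det_id]

theorem extDet_diagonal {S : Type*} [CommRing S] {n : ℕ} (m : ℕ) (hm : 1 ≤ m) (d : Fin n → S) :
    extDet m (Matrix.diagonal d) = (∏ i, d i) ^ (Nat.choose (n - 1) (m - 1)) := by
  classical
  have h : exteriorPower.map m (Matrix.diagonal d).mulVecLin =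
      Matrix.toLin ((Pi.basisFun S (Fin n)).exteriorPower m)
        ((Pi.basisFun S (Fin n)).exteriorPower m)
        (Matrix.diagonal fun s : Set.powersetCard (Fin n) m => ∏ i ∈ (s : Finset (Fin n)), d i) := by
    apply ((Pi.basisFun S (Fin n)).exteriorPower m).ext
    intro s
    rw [Matrix.toLin_self]
    simp only [Matrix.diagonal_apply, ite_smul, zero_smul, Finset.sum_ite_eq', Finset.sum_ite_eq,
      Finset.mem_univ, if_true]
    rw [exteriorPower.basis_apply, exteriorPower.ιMulti_family, exteriorPower.map_apply_ιMulti]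
    have : (fun i => d (Set.powersetCard.ofFinEmbEquiv.symm s i) •
        ((Pi.basisFun S (Fin n)) ∘ (Set.powersetCard.ofFinEmbEquiv.symm s)) i) =
        (Matrix.diagonal d).mulVecLin ∘
          ((Pi.basisFun S (Fin n)) ∘ (Set.powersetCard.ofFinEmbEquiv.symm s)) := by
      funext i
      ext j
      simp [Pi.single_apply, Matrix.diagonal_apply]
    rw [← this]
    rw [AlternatingMap.map_smul_univ]
    congr 1
    rw [Set.powersetCard.ofFinEmbEquiv_symm_apply]
    conv_rhs => rw [← Finset.map_orderEmbOfFin_univ s.val s.prop]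
    rw [Finset.prod_map]
    rfl
  rw [extDet, h, LinearMap.det_toLin, Matrix.det_diagonal]
  have e : ∏ s : Set.powersetCard (Fin n) m, ∏ i ∈ (s : Finset (Fin n)), d i
      = ∏ s ∈ Finset.powersetCard m (Finset.univ : Finset (Fin n)), ∏ i ∈ s, d i := by
    symm
    apply Finset.prod_subtype
    intro x
    simp [Set.powersetCard]
  rw [e, ← Finset.prod_pow]
  rw [Finset.prod_comm' (t' := Finset.univ)
    (s' := fun i => (Finset.powersetCard m Finset.univ).filter (fun s => {i} ⊆ s)) (by simp)]
  refine Finset.prod_congr rfl fun i _ => ?_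
  rw [Finset.prod_const, Finset.card_filter_powersetCard_subset]
  · simp
  · simp
  · simpa using hm

theorem extDet_transvection {K : Type*} [Field K] [CharZero K] {n : ℕ} (m : ℕ) {i j : Fin n}
    (hij : i ≠ j) (c : K) : extDet m (Matrix.transvection i j c) = 1 := by
  have hD : extDet m (Matrix.diagonal (Function.update 1 i (2 : K))) *
      extDet m (Matrix.diagonal (Function.update 1 i (2⁻¹ : K))) = 1 := by
    rw [← extDet_mul, ← extDet_one (S := K) (n := n) m, Matrix.diagonal_mul_diagonal,
      ← Matrix.diagonal_one]
    congr 2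
    funext k
    by_cases h : k = i <;> simp [h]
  have hT : extDet m (Matrix.transvection i j c) * extDet m (Matrix.transvection i j (-c)) = 1 := by
    rw [← extDet_mul, Matrix.transvection_mul_transvection_same _ _ hij]
    simp [extDet_one]
  have hc : Matrix.diagonal (Function.update 1 i (2 : K)) * Matrix.transvection i j c =
      Matrix.transvection i j c * Matrix.transvection i j c *
        Matrix.diagonal (Function.update 1 i (2 : K)) := by
    rw [Matrix.transvection_mul_transvection_same _ _ hij]
    ext a b
    simp only [Matrix.diagonal_mul, Matrix.mul_diagonal, Matrix.transvection, Matrix.add_apply,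
      Matrix.one_apply, Matrix.single_apply, Function.update_apply, Pi.one_apply]
    split_ifs <;> grind
  have := congrArg (extDet m) hc
  simp only [extDet_mul] at this
  have h1 := left_ne_zero_of_mul_eq_one hD
  have h2 := left_ne_zero_of_mul_eq_one hT
  apply mul_left_cancel₀ h2
  apply mul_left_cancel₀ h1
  linear_combination -this

theorem extDet_field {K : Type*} [Field K] [CharZero K] {n : ℕ} (m : ℕ) (hm : 1 ≤ m)
    (A : Matrix (Fin n) (Fin n) K) : extDet m A = A.det ^ (Nat.choose (n - 1) (m - 1)) := by
  induction A using Matrix.diagonal_transvection_induction with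
  | hdiag D _ => rw [extDet_diagonal m hm, Matrix.det_diagonal]
  | htransvec t =>
    rw [Matrix.TransvectionStruct.det, one_pow]
    exact extDet_transvection m t.hij t.c
  | hmul A B hA hB => rw [extDet_mul, hA, hB, Matrix.det_mul, mul_pow]

theorem extDet_ring {S : Type*} [CommRing S] {n : ℕ} (m : ℕ) (hm : 1 ≤ m)
    (A : Matrix (Fin n) (Fin n) S) : extDet m A = A.det ^ (Nat.choose (n - 1) (m - 1)) := by
  have huniv : extDet m (Matrix.mvPolynomialX (Fin n) (Fin n) ℤ) =
      (Matrix.mvPolynomialX (Fin n) (Fin n) ℤ).det ^ (Nat.choose (n - 1) (m - 1)) := by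
    let φ := algebraMap (MvPolynomial (Fin n × Fin n) ℤ)
      (FractionRing (MvPolynomial (Fin n × Fin n) ℤ))
    have hφ : Function.Injective φ := IsFractionRing.injective _ _
    haveI : CharZero (FractionRing (MvPolynomial (Fin n × Fin n) ℤ)) :=
      charZero_of_injective_algebraMap hφ
    apply hφ
    rw [← extDet_map, extDet_field m hm, map_pow, RingHom.map_det]
    rfl
  have hA := Matrix.mvPolynomialX_map_eval₂ (Int.castRingHom S) A
  have hA' : (Matrix.mvPolynomialX (Fin n) (Fin n) ℤ).map
      (MvPolynomial.eval₂Hom (Int.castRingHom S) fun p : Fin n × Fin n => A p.1 p.2) = A := hA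
  rw [← hA', extDet_map, huniv, map_pow, RingHom.map_det]
  rfl

/-- `det(⋀^m g) = det(g)^{C(n−1,m−1)}`. -/
theorem det_exteriorPower (R : Type*) [CommRing R] (n m : ℕ) (hm : 1 ≤ m)
    (g : GL (Fin n) R) :
    LinearMap.det (extPow m ((g : Matrix (Fin n) (Fin n) R).mulVecLin)) =
      ((g : Matrix (Fin n) (Fin n) R).det) ^ (Nat.choose (n - 1) (m - 1)) := by
  rw [extPow_eq_map]
  exact extDet_ring m hm _
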